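/- Let a ≥ 0 and for each k ∈ ℕ set β_k := √((k+1/2)² + a). Then there exists a constant C > 0 such that for every ρ ∈ (0, 1], Σ_{k=0}^∞ ((2k+1)/Γ(1+β_k)) (ρ/2)^{β_k} ≤ C ρ^{β₀}. In particular the series Σ_{k=0}^∞ (2k+1)/Γ(1+β_k) converges. (This is the small-ρ bound |Π₂| ≤ C ρ^{β₀ − 1/2} for the kernel K in the proof of Lemma 2.1, after applying the standard Bessel bound |J_ν(ρ)| ≤ (ρ/2)^ν e^{ρ²/4}/Γ(1+ν).) -/

import Mathlib

/-- `β_k = √((k+1/2)² + a)`. -/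
noncomputable def betaCoef (a : ℝ) (k : ℕ) : ℝ :=
  Real.sqrt (((k : ℝ) + 1 / 2) ^ 2 + a)

lemma natCast_add_half_le_betaCoef {a : ℝ} (ha : 0 ≤ a) (k : ℕ) :
    (k : ℝ) + 1 / 2 ≤ betaCoef a k :=
  Real.le_sqrt_of_sq_le (by linarith)

lemma betaCoef_mono (a : ℝ) : Monotone (betaCoef a) := fun j k h => by
  have h' : (j : ℝ) ≤ k := by exact_mod_cast h
  unfold betaCoef
  gcongr

lemma Gamma_one_add_betaCoef_pos (a : ℝ) (k : ℕ) :
    0 < Real.Gamma (1 + betaCoef a k) :=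
  Real.Gamma_pos_of_pos (add_pos_of_pos_of_nonneg one_pos (Real.sqrt_nonneg _))

lemma factorial_le_Gamma_one_add_betaCoef {a : ℝ} (ha : 0 ≤ a) {k : ℕ} (hk : 1 ≤ k) :
    (k.factorial : ℝ) ≤ Real.Gamma (1 + betaCoef a k) := by
  have hk' : (1 : ℝ) ≤ k := by exact_mod_cast hk
  have hb := natCast_add_half_le_betaCoef ha k
  rw [← Real.Gamma_nat_eq_factorial]
  exact Real.Gamma_strictMonoOn_Ici.monotoneOn (Set.mem_Ici.2 (by linarith))
    (Set.mem_Ici.2 (by linarith)) (by linarith)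

lemma summable_div_Gamma_one_add_betaCoef {a : ℝ} (ha : 0 ≤ a) :
    Summable (fun k : ℕ => (2 * (k : ℝ) + 1) / Real.Gamma (1 + betaCoef a k)) := by
  refine (Real.summable_pow_div_factorial 3).of_norm_bounded_eventually_nat ?_
  filter_upwards [Filter.eventually_ge_atTop 1] with k hk
  have hpos := Gamma_one_add_betaCoef_pos a k
  rw [Real.norm_of_nonneg (by positivity)]
  have hpow : 2 * (k : ℝ) + 1 ≤ 3 ^ k := by
    have := one_add_mul_le_pow (show (-2 : ℝ) ≤ 2 by norm_num) k
    norm_num at this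
    linarith
  exact div_le_div₀ (by positivity) hpow (by positivity)
    (factorial_le_Gamma_one_add_betaCoef ha hk)

theorem stmt8 (a : ℝ) (ha : 0 ≤ a) :
    ∃ C > 0,
      Summable (fun k : ℕ => (2 * (k : ℝ) + 1) / Real.Gamma (1 + betaCoef a k)) ∧
      ∀ ρ : ℝ, 0 < ρ → ρ ≤ 1 →
        Summable (fun k : ℕ =>
          (2 * (k : ℝ) + 1) / Real.Gamma (1 + betaCoef a k) * (ρ / 2) ^ betaCoef a k) ∧
        (∑' k : ℕ, (2 * (k : ℝ) + 1) / Real.Gamma (1 + betaCoef a k) * (ρ / 2) ^ betaCoef a k)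
          ≤ C * ρ ^ betaCoef a 0 := by
  have hsum := summable_div_Gamma_one_add_betaCoef ha
  have hcoef (k : ℕ) : 0 < (2 * (k : ℝ) + 1) / Real.Gamma (1 + betaCoef a k) :=
    div_pos (by positivity) (Gamma_one_add_betaCoef_pos a k)
  refine ⟨_, hsum.tsum_pos (fun k => (hcoef k).le) 0 (hcoef 0), hsum, fun ρ hρ hρ1 => ?_⟩
  have hle (k : ℕ) :
      (2 * (k : ℝ) + 1) / Real.Gamma (1 + betaCoef a k) * (ρ / 2) ^ betaCoef a k ≤
        (2 * (k : ℝ) + 1) / Real.Gamma (1 + betaCoef a k) * ρ ^ betaCoef a 0 := by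
    refine mul_le_mul_of_nonneg_left ?_ (hcoef k).le
    calc (ρ / 2) ^ betaCoef a k ≤ ρ ^ betaCoef a k :=
          Real.rpow_le_rpow (by positivity) (by linarith) (Real.sqrt_nonneg _)
      _ ≤ ρ ^ betaCoef a 0 :=
          Real.rpow_le_rpow_of_exponent_ge hρ hρ1 (betaCoef_mono a k.zero_le)
  have hsum' := hsum.mul_right (ρ ^ betaCoef a 0)
  have hρsum := Summable.of_nonneg_of_le
    (fun k => mul_nonneg (hcoef k).le (Real.rpow_nonneg (by positivity) _)) hle hsum'
  refine ⟨hρsum, ?_⟩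
  rw [← tsum_mul_right]
  exact hρsum.tsum_le_tsum hle hsum'
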